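/- arXiv:1511.09446 — 2 statements merged into one kernel-verified Lean document; each statement's English description precedes it below -/
import Mathlib

section
/- Let N and s be natural numbers with 0 < s ≤ N. For a ∈ ZMod N define the cyclic interval I(a) of length s starting at a to be the set {a, a+1, …, a+s−1} ⊆ ZMod N. Let S be a finite set of elements of ZMod N such that for any two distinct a, b ∈ S, the intersection I(a) ∩ I(b) has fewer than s/2 elements (i.e., 2·|I(a) ∩ I(b)| < s). Then |S|·s ≤ 2N. -/
/-- The naturals below `N` translate injectively from any starting point of `ZMod N`. -/
theorem ZMod.add_natCast_injOn (N : ℕ) (a : ZMod N) :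
    Set.InjOn (fun i : ℕ => a + (i : ZMod N)) (Set.Iio N) := by
  intro i hi j hj h
  have h' := (ZMod.natCast_eq_natCast_iff' i j N).1 (add_left_cancel h)
  rwa [Nat.mod_eq_of_lt hi, Nat.mod_eq_of_lt hj] at h'

/-- A cyclic interval of length `s ≤ N` and its translate by `d` share at least `s - d` points. -/
theorem ZMod.sub_le_card_interval_inter {N s : ℕ} (hsN : s ≤ N) (b : ZMod N) (d : ℕ) :
    s - d ≤ ((Finset.range s).image (fun i : ℕ => b + (d : ZMod N) + (i : ZMod N)) ∩
      (Finset.range s).image (fun i : ℕ => b + (i : ZMod N))).card := by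
  have hinj : Set.InjOn (fun k : ℕ => b + (d : ZMod N) + (k : ZMod N))
      (Finset.range (s - d)) :=
    (ZMod.add_natCast_injOn N _).mono fun k hk => by
      simp only [Finset.coe_range, Set.mem_Iio] at hk ⊢
      omega
  rw [← Finset.card_range (s - d), ← Finset.card_image_of_injOn hinj]
  refine Finset.card_le_card fun x hx => ?_
  obtain ⟨k, hk, rfl⟩ := Finset.mem_image.1 hx
  rw [Finset.mem_range] at hk
  refine Finset.mem_inter.2 ⟨Finset.mem_image.2 ⟨k, Finset.mem_range.2 (by omega), rfl⟩,
    Finset.mem_image.2 ⟨d + k, Finset.mem_range.2 (by omega), ?_⟩⟩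
  push_cast
  ring

/-- Interval packing on a cycle: if `S` is a family of starting points of cyclic intervals of
length `s` in `ZMod N` such that any two distinct intervals intersect in fewer than `s / 2`
points, then `|S| * s ≤ 2 * N`. -/
theorem cyclic_interval_packing
    (N s : ℕ) (hs : 0 < s) (hsN : s ≤ N)
    (I : ZMod N → Finset (ZMod N))
    (hI : ∀ a : ZMod N, I a = (Finset.range s).image (fun i : ℕ => (a + (i : ZMod N))))
    (S : Finset (ZMod N))
    (hsep : ∀ a ∈ S, ∀ b ∈ S, a ≠ b → 2 * ((I a) ∩ (I b)).card < s) :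
    S.card * s ≤ 2 * N := by
  have : NeZero N := ⟨by omega⟩
  have key : ∀ a ∈ S, ∀ b ∈ S, ∀ i j : ℕ, i ≤ j → j < (s + 1) / 2 →
      a + (i : ZMod N) = b + (j : ZMod N) → a = b := by
    intro a ha b hb i j hij hj h
    by_contra hne
    have hab : a = b + ((j - i : ℕ) : ZMod N) := by
      rw [Nat.cast_sub hij]
      linear_combination h
    have hlt := hsep a ha b hb hne
    have hle := ZMod.sub_le_card_interval_inter hsN b (j - i)
    rw [← hab, ← hI, ← hI] at hle
    omega
  -- The first halves of the intervals are pairwise disjoint.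
  have hinj : Set.InjOn (fun p : ZMod N × ℕ => p.1 + (p.2 : ZMod N))
      (S ×ˢ Finset.range ((s + 1) / 2) : Finset (ZMod N × ℕ)) := by
    rintro ⟨a, i⟩ hp ⟨b, j⟩ hq h
    simp only [Finset.mem_coe, Finset.mem_product, Finset.mem_range] at hp hq h
    have hab : a = b := by
      rcases le_total i j with hij | hij
      · exact key a hp.1 b hq.1 i j hij hq.2 h
      · exact (key b hq.1 a hp.1 j i hij hp.2 h.symm).symm
    subst hab
    have hij : i = j := ZMod.add_natCast_injOn N a
      (show i < N by omega) (show j < N by omega) h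
    rw [hij]
  have hcard : S.card * ((s + 1) / 2) ≤ N := by
    have h := Finset.card_le_univ ((S ×ˢ Finset.range ((s + 1) / 2)).image
      fun p : ZMod N × ℕ => p.1 + (p.2 : ZMod N))
    rwa [Finset.card_image_of_injOn hinj, Finset.card_product, Finset.card_range,
      ZMod.card] at h
  calc S.card * s ≤ S.card * (2 * ((s + 1) / 2)) := Nat.mul_le_mul_left _ (by omega)
    _ = 2 * (S.card * ((s + 1) / 2)) := by ring
    _ ≤ 2 * N := Nat.mul_le_mul_left _ hcard
end

section
/- Let m ≥ 1 and let f : ZMod m → Bool. Suppose there are natural numbers n₁ < n₂ < n₃ < n₄ < n₅ < n₆ < m such that, writing i_j for the image of n_j in ZMod m, one has f(i₁) ≠ f(i₂), f(i₃) ≠ f(i₄), and f(i₅) ≠ f(i₆). Then the set { j ∈ ZMod m : f(j) ≠ f(j+1) } has at least 3 elements. -/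
/-- A sequence taking different values at `a ≤ b` changes value at some step in `[a, b)`. -/
theorem exists_ne_succ_of_ne {α : Type*} (g : ℕ → α) {a b : ℕ} (hab : a ≤ b)
    (h : g a ≠ g b) : ∃ k, a ≤ k ∧ k < b ∧ g k ≠ g (k + 1) := by
  contrapose! h
  induction b, hab using Nat.le_induction with
  | base => rfl
  | succ b hab ih =>
    exact (ih fun k hk hkb => h k hk (by omega)).trans (h b hab (by omega))

theorem ZMod.natCast_ne_natCast_of_lt {m a b : ℕ} (hab : a < b) (hb : b < m) :
    (a : ZMod m) ≠ (b : ZMod m) := by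
  rw [Ne, ZMod.natCast_eq_natCast_iff', Nat.mod_eq_of_lt (hab.trans hb), Nat.mod_eq_of_lt hb]
  exact hab.ne

/-- If a two-coloring `f` of `m` cyclically ordered points has three disjoint pairs of
positions (in increasing order) at which the colors differ, then there are at least three
color-change positions `j` (where `f j ≠ f (j + 1)`). -/
theorem three_color_changes
    (m : ℕ) (hm : 1 ≤ m) (f : ZMod m → Bool)
    (n₁ n₂ n₃ n₄ n₅ n₆ : ℕ)
    (h12 : n₁ < n₂) (h23 : n₂ < n₃) (h34 : n₃ < n₄) (h45 : n₄ < n₅) (h56 : n₅ < n₆)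
    (h6m : n₆ < m)
    (hf12 : f (n₁ : ZMod m) ≠ f (n₂ : ZMod m))
    (hf34 : f (n₃ : ZMod m) ≠ f (n₄ : ZMod m))
    (hf56 : f (n₅ : ZMod m) ≠ f (n₆ : ZMod m)) :
    3 ≤ Set.ncard { j : ZMod m | f j ≠ f (j + 1) } := by
  have : NeZero m := ⟨by omega⟩
  obtain ⟨a, ha, ha', hfa⟩ := exists_ne_succ_of_ne (fun k : ℕ => f (k : ZMod m)) h12.le hf12
  obtain ⟨b, hb, hb', hfb⟩ := exists_ne_succ_of_ne (fun k : ℕ => f (k : ZMod m)) h34.le hf34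
  obtain ⟨c, hc, hc', hfc⟩ := exists_ne_succ_of_ne (fun k : ℕ => f (k : ZMod m)) h56.le hf56
  push_cast at hfa hfb hfc
  exact (Set.two_lt_ncard_iff (Set.toFinite _)).2 ⟨a, b, c, hfa, hfb, hfc,
    ZMod.natCast_ne_natCast_of_lt (by omega) (by omega),
    ZMod.natCast_ne_natCast_of_lt (by omega) (by omega),
    ZMod.natCast_ne_natCast_of_lt (by omega) (by omega)⟩
end
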